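/- For every matrix G ∈ SU(2,1;ℤ[i]) there exists a natural number n such that after n applications of the reduction step (each step replacing the current matrix H with (1,3)-entry h₁₃ ≠ 0 by J · N_{(γ, ½|γ|² + i k)} · H for some Gaussian integer γ with |γ|² even and some integer k), one reaches a matrix whose (1,3)-entry is 0; equivalently, there exist matrices T₁, …, T_n, each of the form J · N_{(γ, ½|γ|² + i k)} with γ a Gaussian integer of even norm and k ∈ ℤ, such that T_n ⋯ T₁ · G is lower triangular. -/

import Mathlib

open Matrix Complex

/-- The matrix `C` of the quadratic form defining the Siegel domain. -/
noncomputable def Cmat : Matrix (Fin 3) (Fin 3) ℂ := !![0,0,-1; 0,1,0; -1,0,0]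

/-- Membership in `SU(2,1)`: `Gᴴ C G = C` and `det G = 1`. -/
def inSU21 (G : Matrix (Fin 3) (Fin 3) ℂ) : Prop :=
  G.conjTranspose * Cmat * G = Cmat ∧ G.det = 1

/-- A complex number is a Gaussian integer. -/
def IsGaussianInt (z : ℂ) : Prop := ∃ m n : ℤ, z = (m : ℂ) + (n : ℂ) * Complex.I

/-- The Heisenberg translation matrix `N_a` for `a = (a₁, a₂) ∈ ℂ²`. -/
noncomputable def N (a : ℂ × ℂ) : Matrix (Fin 3) (Fin 3) ℂ :=
  !![1, 0, 0; a.1, 1, 0; a.2, star a.1, 1]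

/-- The rotation matrix `M_i = diag(i, -1, i)`. -/
noncomputable def Mi : Matrix (Fin 3) (Fin 3) ℂ :=
  !![Complex.I, 0, 0; 0, -1, 0; 0, 0, Complex.I]

/-- The involution `J`. -/
noncomputable def Jmat : Matrix (Fin 3) (Fin 3) ℂ := !![0, 0, -1; 0, -1, 0; -1, 0, 0]

/-- `N_{(0,i)}` as an element of `SL(3,ℂ)`. -/
noncomputable def N0i : Matrix.SpecialLinearGroup (Fin 3) ℂ :=
  ⟨N (0, Complex.I), by simp [N, Matrix.det_fin_three]⟩

/-- `N_{(1+i,1)}` as an element of `SL(3,ℂ)`. -/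
noncomputable def N1 : Matrix.SpecialLinearGroup (Fin 3) ℂ :=
  ⟨N (1 + Complex.I, 1), by simp [N, Matrix.det_fin_three]⟩

/-- `M_i` as an element of `SL(3,ℂ)`. -/
noncomputable def MiSL : Matrix.SpecialLinearGroup (Fin 3) ℂ :=
  ⟨Mi, by simp [Mi, Matrix.det_fin_three]⟩

/-- `J` as an element of `SL(3,ℂ)`. -/
noncomputable def JSL : Matrix.SpecialLinearGroup (Fin 3) ℂ :=
  ⟨Jmat, by simp [Jmat, Matrix.det_fin_three]⟩

/-- `N_{(0,i)}` as an invertible matrix. -/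
noncomputable def N0iGL : GL (Fin 3) ℂ := N0i.toGL
/-- `N_{(1+i,1)}` as an invertible matrix. -/
noncomputable def N1GL : GL (Fin 3) ℂ := N1.toGL
/-- `M_i` as an invertible matrix. -/
noncomputable def MiGL : GL (Fin 3) ℂ := MiSL.toGL
/-- `J` as an invertible matrix. -/
noncomputable def JGL : GL (Fin 3) ℂ := JSL.toGL

namespace IsGaussianInt

lemma intCast (m : ℤ) : IsGaussianInt m := ⟨m, 0, by simp⟩

lemma zero : IsGaussianInt 0 := by simpa using intCast 0

lemma one : IsGaussianInt 1 := by simpa using intCast 1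

lemma add {z w : ℂ} (hz : IsGaussianInt z) (hw : IsGaussianInt w) : IsGaussianInt (z + w) := by
  obtain ⟨a, b, rfl⟩ := hz
  obtain ⟨c, d, rfl⟩ := hw
  exact ⟨a + c, b + d, by push_cast; ring⟩

lemma neg {z : ℂ} (hz : IsGaussianInt z) : IsGaussianInt (-z) := by
  obtain ⟨a, b, rfl⟩ := hz
  exact ⟨-a, -b, by push_cast; ring⟩

lemma mul {z w : ℂ} (hz : IsGaussianInt z) (hw : IsGaussianInt w) : IsGaussianInt (z * w) := by
  obtain ⟨a, b, rfl⟩ := hz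
  obtain ⟨c, d, rfl⟩ := hw
  refine ⟨a * c - b * d, a * d + b * c, ?_⟩
  push_cast
  linear_combination (b * d : ℂ) * I_mul_I

lemma star {z : ℂ} (hz : IsGaussianInt z) : IsGaussianInt (star z) := by
  obtain ⟨a, b, rfl⟩ := hz
  exact ⟨a, -b, by simp⟩

lemma matrix_mul {A B : Matrix (Fin 3) (Fin 3) ℂ} (hA : ∀ j k, IsGaussianInt (A j k))
    (hB : ∀ j k, IsGaussianInt (B j k)) (j k : Fin 3) : IsGaussianInt ((A * B) j k) := by
  rw [Matrix.mul_apply, Fin.sum_univ_three]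
  exact (((hA _ _).mul (hB _ _)).add ((hA _ _).mul (hB _ _))).add ((hA _ _).mul (hB _ _))

lemma exists_normSq_eq_natCast {z : ℂ} (hz : IsGaussianInt z) : ∃ n : ℕ, normSq z = n := by
  obtain ⟨a, b, rfl⟩ := hz
  refine ⟨(a * a + b * b).natAbs, ?_⟩
  have h : ((a * a + b * b).natAbs : ℤ) = a * a + b * b :=
    Int.natAbs_of_nonneg (add_nonneg (mul_self_nonneg a) (mul_self_nonneg b))
  have h' : (((a * a + b * b).natAbs : ℤ) : ℝ) = a * a + b * b := by rw [h]; push_cast; rfl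
  rw [Int.cast_natCast] at h'
  rw [h']
  simp [normSq_apply]

end IsGaussianInt

lemma inSU21.mul {A B : Matrix (Fin 3) (Fin 3) ℂ} (hA : inSU21 A) (hB : inSU21 B) :
    inSU21 (A * B) := by
  refine ⟨?_, by rw [det_mul, hA.2, hB.2, one_mul]⟩
  calc (A * B)ᴴ * Cmat * (A * B) = Bᴴ * (Aᴴ * Cmat * A) * B := by
        simp only [conjTranspose_mul, Matrix.mul_assoc]
    _ = Cmat := by rw [hA.1, hB.1]

lemma inSU21_Jmat : inSU21 Jmat := by
  refine ⟨?_, by simp [Jmat, det_fin_three]⟩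
  ext j k
  fin_cases j <;> fin_cases k <;>
    simp [Jmat, Cmat, Matrix.mul_apply, Fin.sum_univ_three]

lemma inSU21_N {a : ℂ × ℂ} (ha : a.2 + star a.2 = a.1 * star a.1) : inSU21 (N a) := by
  refine ⟨?_, by simp [N, det_fin_three]⟩
  have ha' : a.2 + (starRingEnd ℂ) a.2 = a.1 * (starRingEnd ℂ) a.1 := ha
  ext j k
  fin_cases j <;> fin_cases k <;>
    simp [N, Cmat, Matrix.mul_apply, Fin.sum_univ_three]
  linear_combination -ha'

/-- The third column of a matrix in `SU(2,1)` is isotropic. -/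
lemma inSU21.third_column_isotropic {G : Matrix (Fin 3) (Fin 3) ℂ} (hG : inSU21 G) :
    star (G 1 2) * G 1 2 = star (G 0 2) * G 2 2 + star (G 2 2) * G 0 2 := by
  have h := congrFun (congrFun hG.1 2) 2
  simp [Cmat, Matrix.mul_apply, Fin.sum_univ_three] at h
  simp only [RCLike.star_def]
  linear_combination h

lemma inSU21.lower_triangular {G : Matrix (Fin 3) (Fin 3) ℂ} (hG : inSU21 G) (h0 : G 0 2 = 0) :
    G 0 1 = 0 ∧ G 0 2 = 0 ∧ G 1 2 = 0 := by
  have h12 : G 1 2 = 0 := by simpa [h0] using hG.third_column_isotropic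
  have h22 : G 2 2 ≠ 0 := by
    intro h
    have hdet := hG.2
    simp [det_fin_three, h0, h12, h] at hdet
  refine ⟨?_, h0, h12⟩
  have h := congrFun (congrFun hG.1 2) 1
  simpa [Cmat, Matrix.mul_apply, Fin.sum_univ_three, h0, h12, h22] using h

/-- The ideal `(1 + i)ℤ[i]` has covering radius at most one in `ℂ`. -/
lemma exists_even_gaussianInt_near (p : ℂ) : ∃ γ : ℂ, IsGaussianInt γ ∧
    (∃ t : ℤ, γ * star γ = 2 * (t : ℂ)) ∧ normSq (γ + p) ≤ 1 := by
  set m := round ((p.re + p.im) / 2) with hm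
  set n := round ((p.im - p.re) / 2) with hn
  have h1 := abs_le.1 (abs_sub_round ((p.re + p.im) / 2))
  have h2 := abs_le.1 (abs_sub_round ((p.im - p.re) / 2))
  rw [← hm] at h1
  rw [← hn] at h2
  refine ⟨((n - m : ℤ) : ℂ) + ((-m - n : ℤ) : ℂ) * I, ⟨_, _, rfl⟩, ⟨m * m + n * n, ?_⟩, ?_⟩
  · apply Complex.ext <;> simp <;> ring
  · simp [normSq_apply]
    nlinarith [mul_nonneg (sub_nonneg.2 h1.1) (sub_nonneg.2 h1.2),
      mul_nonneg (sub_nonneg.2 h2.1) (sub_nonneg.2 h2.2)]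

lemma exists_heisenberg_translate_normSq_le {p q : ℂ} (hpq : normSq p = 2 * q.re) :
    ∃ (γ : ℂ) (k : ℤ), IsGaussianInt γ ∧ (∃ t : ℤ, γ * star γ = 2 * (t : ℂ)) ∧
      normSq (γ * star γ / 2 + (k : ℂ) * I + star γ * p + q) ≤ 1 / 2 := by
  obtain ⟨γ, hγ, ht, hn⟩ := exists_even_gaussianInt_near p
  set y := (star γ * p + q).im with hy
  refine ⟨γ, -round y, hγ, ht, ?_⟩
  have hγγ : γ * star γ / 2 = ((normSq γ / 2 : ℝ) : ℂ) := by
    rw [RCLike.star_def, mul_conj]; push_cast; rfl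
  have hre : (γ * star γ / 2 + ((-round y : ℤ) : ℂ) * I + star γ * p + q).re
      = normSq (γ + p) / 2 := by
    rw [hγγ]
    simp [normSq_apply] at hpq ⊢
    linarith
  have him : (γ * star γ / 2 + ((-round y : ℤ) : ℂ) * I + star γ * p + q).im = y - round y := by
    rw [hγγ, hy]
    simp
    ring
  rw [normSq_apply, hre, him]
  have h := abs_le.1 (abs_sub_round y)
  nlinarith [normSq_nonneg (γ + p), mul_nonneg (sub_nonneg.2 h.1) (sub_nonneg.2 h.2)]

/-- The matrices `J · N_{(γ, ½|γ|² + i k)}` used in a reduction step. -/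
def IsReductionStep (T : Matrix (Fin 3) (Fin 3) ℂ) : Prop :=
  ∃ (γ : ℂ) (k : ℤ), IsGaussianInt γ ∧ (∃ t : ℤ, γ * star γ = 2 * (t : ℂ)) ∧
    T = Jmat * N (γ, γ * star γ / 2 + (k : ℂ) * Complex.I)

lemma IsReductionStep.inSU21 {T : Matrix (Fin 3) (Fin 3) ℂ} (hT : IsReductionStep T) :
    inSU21 T := by
  obtain ⟨γ, k, -, -, rfl⟩ := hT
  refine inSU21_Jmat.mul (inSU21_N ?_)
  simp
  ring

lemma IsReductionStep.isGaussianInt {T : Matrix (Fin 3) (Fin 3) ℂ} (hT : IsReductionStep T) :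
    ∀ j k, IsGaussianInt (T j k) := by
  obtain ⟨γ, k, hγ, ⟨t, ht⟩, rfl⟩ := hT
  have hδ : IsGaussianInt (γ * star γ / 2 + (k : ℂ) * I) := ⟨t, k, by rw [ht]; ring⟩
  refine IsGaussianInt.matrix_mul (fun i j => ?_) (fun i j => ?_)
  · fin_cases i <;> fin_cases j <;>
      first | exact IsGaussianInt.zero | exact IsGaussianInt.one.neg
  · fin_cases i <;> fin_cases j <;>
      first
        | exact IsGaussianInt.zero
        | exact IsGaussianInt.one
        | exact hγ
        | exact hγ.star
        | exact hδ

lemma exists_isReductionStep_normSq_lt {G : Matrix (Fin 3) (Fin 3) ℂ} (hG : inSU21 G)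
    (h0 : G 0 2 ≠ 0) :
    ∃ T, IsReductionStep T ∧ normSq ((T * G) 0 2) < normSq (G 0 2) := by
  have hpq : normSq (G 1 2 / G 0 2) = 2 * (G 2 2 / G 0 2).re := by
    have h := hG.third_column_isotropic
    have h0' : (starRingEnd ℂ) (G 0 2) ≠ 0 := by simpa using h0
    apply ofReal_injective
    rw [ofReal_mul, ofReal_ofNat, re_eq_add_conj, normSq_eq_conj_mul_self]
    simp only [RCLike.star_def] at h
    simp only [map_div₀]
    field_simp
    linear_combination h
  obtain ⟨γ, k, hγ, ht, hle⟩ := exists_heisenberg_translate_normSq_le hpq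
  refine ⟨_, ⟨γ, k, hγ, ht, rfl⟩, ?_⟩
  have hentry : (Jmat * N (γ, γ * star γ / 2 + (k : ℂ) * I) * G) 0 2
      = -((γ * star γ / 2 + (k : ℂ) * I + star γ * (G 1 2 / G 0 2) + G 2 2 / G 0 2)
        * G 0 2) := by
    simp [Jmat, N, Matrix.mul_apply, Fin.sum_univ_three]
    field_simp
    ring
  rw [hentry, normSq_neg, normSq_mul]
  have hpos := normSq_pos.2 h0
  nlinarith

/-- The reduction procedure terminates: any `G ∈ SU(2,1;ℤ[i])` is carried to a lower
triangular matrix by finitely many reduction steps `H ↦ J · N_{(γ, ½|γ|² + i k)} · H`. -/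
theorem reduction_terminates (G : Matrix (Fin 3) (Fin 3) ℂ) (hG : inSU21 G)
    (hZ : ∀ j k, IsGaussianInt (G j k)) :
    ∃ L : List (Matrix (Fin 3) (Fin 3) ℂ),
      (∀ T ∈ L, ∃ (γ : ℂ) (k : ℤ), IsGaussianInt γ ∧
        (∃ t : ℤ, γ * star γ = 2 * (t : ℂ)) ∧
        T = Jmat * N (γ, γ * star γ / 2 + (k : ℂ) * Complex.I)) ∧
      ((L.prod * G) 0 1 = 0 ∧ (L.prod * G) 0 2 = 0 ∧ (L.prod * G) 1 2 = 0) := by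
  obtain ⟨n, hn⟩ := (hZ 0 2).exists_normSq_eq_natCast
  induction n using Nat.strong_induction_on generalizing G with
  | _ n ih =>
    by_cases h0 : G 0 2 = 0
    · exact ⟨[], by simp, by simpa using hG.lower_triangular h0⟩
    · obtain ⟨T, hT, hlt⟩ := exists_isReductionStep_normSq_lt hG h0
      have hTZ := IsGaussianInt.matrix_mul hT.isGaussianInt hZ
      obtain ⟨m, hm⟩ := (hTZ 0 2).exists_normSq_eq_natCast
      rw [hm, hn, Nat.cast_lt] at hlt
      obtain ⟨L, hL, hL'⟩ := ih m hlt (T * G) (hT.inSU21.mul hG) hTZ hm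
      refine ⟨L ++ [T], fun S hS => ?_, ?_⟩
      · rcases List.mem_append.1 hS with hS | hS
        · exact hL S hS
        · rw [List.mem_singleton.1 hS]
          exact hT
      · simpa [Matrix.mul_assoc] using hL'
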